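/- (Feller property.) Let α ∈ [0,1] and let φ : ℝ → ℝ be continuous with φ(x) → 0 as |x| → ∞. Then for every t > 0 the function Q_t φ is continuous on ℝ and satisfies Q_t φ(x) → 0 as |x| → ∞. -/

import Mathlib

open MeasureTheory Real Filter

/-- The Gaussian heat kernel `p(t,x,y) = (2πt)^{-1/2} exp(-(x-y)²/(2t))`. -/
noncomputable def heatKernel (t x y : ℝ) : ℝ :=
  (Real.sqrt (2 * Real.pi * t))⁻¹ * Real.exp (-(x - y) ^ 2 / (2 * t))

/-- The transition kernel of the Skew Brownian motion of parameter `α`: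
`q_α(t,x,y) = p(t,x,y) + (2α-1)·sgn(y)·(2πt)^{-1/2} exp(-(|x|+|y|)²/(2t))`. -/
noncomputable def skewKernel (α t x y : ℝ) : ℝ :=
  heatKernel t x y +
    (2 * α - 1) * Real.sign y * (Real.sqrt (2 * Real.pi * t))⁻¹ *
      Real.exp (-(|x| + |y|) ^ 2 / (2 * t))

/-- The Skew Brownian motion semigroup applied to a function:
`Q_t φ(x) = ∫ q_α(t,x,y) φ(y) dy`. -/
noncomputable def skewSemigroup (α t : ℝ) (φ : ℝ → ℝ) (x : ℝ) : ℝ :=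
  ∫ y, skewKernel α t x y * φ y

/-- A parametric integral dominated by an integrable function, whose integrand is continuous in the
parameter and vanishes at infinity, is continuous and vanishes at infinity. -/
theorem continuous_and_tendsto_zero_integral_of_dominated {F : ℝ → ℝ → ℝ} {bound : ℝ → ℝ}
    (hm : ∀ x, AEStronglyMeasurable (F x)) (hb : ∀ x y, ‖F x y‖ ≤ bound y)
    (hi : Integrable bound) (hc : ∀ y, Continuous fun x => F x y)
    (h0 : ∀ y, Tendsto (fun x => F x y) (cocompact ℝ) (nhds 0)) :
    Continuous (fun x => ∫ y, F x y) ∧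
      Tendsto (fun x => ∫ y, F x y) (cocompact ℝ) (nhds 0) := by
  refine ⟨continuous_of_dominated hm (fun x => .of_forall (hb x)) hi (.of_forall hc), ?_⟩
  have : (cocompact ℝ).IsCountablyGenerated := by
    rw [cocompact_eq_atBot_atTop]
    infer_instance
  simpa using tendsto_integral_filter_of_dominated_convergence (μ := volume) (f := fun _ => (0 : ℝ))
    bound (.of_forall hm) (.of_forall fun x => .of_forall (hb x)) hi (.of_forall h0)

theorem exists_norm_le_of_tendsto_cocompact {φ : ℝ → ℝ} (hφc : Continuous φ)
    (hφ0 : Tendsto φ (cocompact ℝ) (nhds 0)) : ∃ C, ∀ x, ‖φ x‖ ≤ C :=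
  ⟨_, BoundedContinuousFunction.norm_coe_le_norm
    (ZeroAtInftyContinuousMap.toBCF ⟨⟨φ, hφc⟩, hφ0⟩)⟩

theorem integrable_exp_neg_sq_div {t : ℝ} (ht : 0 < t) :
    Integrable fun y : ℝ => Real.exp (-y ^ 2 / (2 * t)) := by
  refine (integrable_exp_neg_mul_sq (b := (2 * t)⁻¹) (by positivity)).congr (.of_forall fun y => ?_)
  dsimp only
  congr 1
  ring

theorem measurable_real_sign : Measurable Real.sign := by
  unfold Real.sign
  exact Measurable.ite measurableSet_Iio measurable_const
    (Measurable.ite measurableSet_Ioi measurable_const measurable_const)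

theorem abs_real_sign_le_one (y : ℝ) : |Real.sign y| ≤ 1 := by
  rcases Real.sign_apply_eq y with h | h | h <;> simp [h]

theorem exp_neg_abs_add_abs_sq_le {t : ℝ} (ht : 0 < t) (x y : ℝ) :
    Real.exp (-(|x| + |y|) ^ 2 / (2 * t)) ≤ Real.exp (-y ^ 2 / (2 * t)) := by
  rw [← sq_abs y]
  gcongr
  exact le_add_of_nonneg_left (abs_nonneg x)

theorem tendsto_exp_neg_abs_add_abs_sq {t : ℝ} (ht : 0 < t) (y : ℝ) :
    Tendsto (fun x : ℝ => Real.exp (-(|x| + |y|) ^ 2 / (2 * t))) (cocompact ℝ) (nhds 0) := by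
  refine Real.tendsto_exp_atBot.comp ?_
  have h : Tendsto (fun x : ℝ => (|x| + |y|) ^ 2) (cocompact ℝ) atTop :=
    (tendsto_pow_atTop two_ne_zero).comp
      (tendsto_atTop_add_const_right _ _ (tendsto_norm_cocompact_atTop (E := ℝ)))
  exact (tendsto_neg_atTop_atBot.comp h).atBot_div_const (by positivity)

theorem measurable_heatKernel (t x : ℝ) : Measurable (heatKernel t x) := by
  unfold heatKernel
  fun_prop

theorem integrable_heatKernel {t : ℝ} (ht : 0 < t) (x : ℝ) : Integrable (heatKernel t x) :=
  ((integrable_exp_neg_sq_div ht).comp_sub_left x).const_mul _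

/-- The heat semigroup has the Feller property. -/
theorem heatKernel_integral_feller {φ : ℝ → ℝ} (hφc : Continuous φ)
    (hφ0 : Tendsto φ (cocompact ℝ) (nhds 0)) {t : ℝ} (ht : 0 < t) :
    Continuous (fun x => ∫ y, heatKernel t x y * φ y) ∧
      Tendsto (fun x => ∫ y, heatKernel t x y * φ y) (cocompact ℝ) (nhds 0) := by
  obtain ⟨C, hC⟩ := exists_norm_le_of_tendsto_cocompact hφc hφ0
  have hshift : (fun x => ∫ y, heatKernel t x y * φ y) =
      fun x => ∫ u, heatKernel t 0 u * φ (x - u) := by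
    funext x
    rw [← integral_sub_left_eq_self _ volume x]
    simp [heatKernel]
  rw [hshift]
  refine continuous_and_tendsto_zero_integral_of_dominated
    (bound := fun u => ‖heatKernel t 0 u‖ * C) (fun x => ?_) (fun x u => ?_)
    ((integrable_heatKernel ht 0).norm.mul_const C) (fun u => by fun_prop) (fun u => ?_)
  · exact ((measurable_heatKernel t 0).mul (by fun_prop)).aestronglyMeasurable
  · rw [norm_mul]
    gcongr
    exact hC _
  · simpa using (hφ0.comp
      (Homeomorph.subRight u).isClosedEmbedding.tendsto_cocompact).const_mul (heatKernel t 0 u)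

theorem skewSemigroup_feller (α : ℝ) (hα : α ∈ Set.Icc (0 : ℝ) 1)
    (φ : ℝ → ℝ) (hφc : Continuous φ)
    (hφ0 : Tendsto φ (Filter.cocompact ℝ) (nhds 0))
    (t : ℝ) (ht : 0 < t) :
    Continuous (skewSemigroup α t φ) ∧
      Tendsto (skewSemigroup α t φ) (Filter.cocompact ℝ) (nhds 0) := by
  obtain ⟨C, hC⟩ := exists_norm_le_of_tendsto_cocompact hφc hφ0
  set c := (Real.sqrt (2 * Real.pi * t))⁻¹
  set F : ℝ → ℝ → ℝ := fun x y =>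
    (2 * α - 1) * Real.sign y * c * Real.exp (-(|x| + |y|) ^ 2 / (2 * t)) * φ y with hF
  have hα' : |2 * α - 1| ≤ 1 := abs_le.2 ⟨by linarith [hα.1], by linarith [hα.2]⟩
  have hm : ∀ x, AEStronglyMeasurable (F x) := fun x => by
    have := measurable_real_sign
    exact Measurable.aestronglyMeasurable (by fun_prop)
  have hb : ∀ x y, ‖F x y‖ ≤ 1 * 1 * |c| * Real.exp (-y ^ 2 / (2 * t)) * C := fun x y => by
    simp only [hF, norm_mul, Real.norm_eq_abs, Real.abs_exp]
    have hsign := abs_real_sign_le_one y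
    have hexp := exp_neg_abs_add_abs_sq_le ht x y
    have hφ : |φ y| ≤ C := hC y
    gcongr
  have hi : Integrable fun y : ℝ => 1 * 1 * |c| * Real.exp (-y ^ 2 / (2 * t)) * C :=
    ((integrable_exp_neg_sq_div ht).const_mul _).mul_const C
  obtain ⟨hFc, hF0⟩ := continuous_and_tendsto_zero_integral_of_dominated hm hb hi
    (fun y => by fun_prop)
    (fun y => by
      simpa using ((tendsto_exp_neg_abs_add_abs_sq ht y).const_mul
        ((2 * α - 1) * Real.sign y * c)).mul_const (φ y))
  obtain ⟨hHc, hH0⟩ := heatKernel_integral_feller hφc hφ0 ht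
  have hsplit : skewSemigroup α t φ =
      fun x => (∫ y, heatKernel t x y * φ y) + ∫ y, F x y := by
    funext x
    rw [← integral_add ((integrable_heatKernel ht x).mul_bdd hφc.aestronglyMeasurable
      (.of_forall hC)) (hi.mono' (hm x) (.of_forall (hb x)))]
    exact integral_congr_ae (.of_forall fun y => add_mul _ _ _)
  rw [hsplit]
  exact ⟨hHc.add hFc, by simpa using hH0.add hF0⟩
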